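/- arXiv:2311.05246 — 2 statements merged into one kernel-verified Lean document; each statement's English description precedes it below -/
import Mathlib

section
/- Let η ∈ α+ℤ (α ∈ C̄) be such that ℓ₀ℓ_r has no roots in {γ ∈ α+ℤ : γ < η}. Then for every f ∈ A with unique representative f₀ + f₁S + ⋯ + f_{r−1}S^{r−1} (f_i ∈ C(x)), val_η(f) = min_{j=1,…,r} ν_q(f_{j−1}(η+q)), where f_{j−1}(η+q) ∈ C̄((q)) denotes the evaluation of the rational function f_{j−1} at η+q. In particular, f is integral at η if and only if no coefficient f_{j−1} has a pole at η. -/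
set_option maxHeartbeats 1000000
set_option synthInstance.maxHeartbeats 200000

open Polynomial Filter

noncomputable section

namespace PRec

variable (C : Type*) [Field C] [CharZero C]

/-- The algebraic closure of the coefficient field. -/
abbrev Cbar := AlgebraicClosure C

/-- The field of formal Laurent series over the algebraic closure. -/
abbrev LS := LaurentSeries (Cbar C)

/-- The Laurent-series variable `q`. -/
def qv : LS C := HahnSeries.single 1 1

open Classical in
/-- The valuation `ν_q`, with `ν_q 0 = ⊤`, valued in the extended reals. -/
def nuq (a : LS C) : EReal := if a = 0 then ⊤ else (((a.order : ℤ) : ℝ) : EReal)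

/-- Evaluation of a rational function at the point `α + m + q`. -/
def evalAt (α : Cbar C) (m : ℤ) (p : RatFunc C) : LS C :=
  RatFunc.eval ((algebraMap (Cbar C) (LS C)).comp (algebraMap C (Cbar C)))
    (algebraMap (Cbar C) (LS C) α + (m : LS C) + qv C) p

/-- Shorthand for the canonical map `C[x] → C(x)`. -/
abbrev toRat : Polynomial C →+* RatFunc C := algebraMap (Polynomial C) (RatFunc C)

variable (ℓ : ℕ → Polynomial C) (r : ℕ)

/-- The solution space `Sol_α(L)` of `L = ℓ₀ + ℓ₁ S + ⋯ + ℓ_r S^r` at `α`,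
indexed so that `b n` stands for the value of the solution at `α + n`. -/
def SolSet (α : Cbar C) : Set (ℤ → LS C) :=
  {b | ∀ n : ℤ, ∑ i ∈ Finset.range (r + 1),
      evalAt C α n (toRat C (ℓ i)) * b (n + i) = 0}

/-- The action of an element `f = f₀ + f₁ S + ⋯ + f_{r-1} S^{r-1}` of
`A = C(x)[S]/⟨L⟩` (represented by its coefficient vector) on a sequence. -/
def elemApply (α : Cbar C) (f : Fin r → RatFunc C) (b : ℤ → LS C) : ℤ → LS C :=
  fun n => ∑ i : Fin r, evalAt C α n (f i) * b (n + (i : ℤ))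

/-- Truncated subtraction on extended reals with the convention `⊤ - ⊤ = ⊤`. -/
def esub (a b : EReal) : EReal := if b = ⊤ then ⊤ else a - b

/-- The value function `val_α` on `A`. -/
def valAt (α : Cbar C) (f : Fin r → RatFunc C) : EReal :=
  ⨅ b ∈ SolSet C ℓ r α,
    esub (nuq C (elemApply C r α f b 0))
      (Filter.liminf (fun n : ℕ => nuq C (b (-(n : ℤ)))) Filter.atTop)

/-- `f ∈ A` is (locally) integral at `α`. -/
def IntegralAt (α : Cbar C) (f : Fin r → RatFunc C) : Prop :=
  0 ≤ valAt C ℓ r α f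

/-- Membership in the local subring `C(x)_α` of rational functions having no pole at `α`. -/
def InLocalRing (α : Cbar C) (f : RatFunc C) : Prop :=
  ∃ p q : Polynomial C, (Polynomial.aeval α) q ≠ 0 ∧ f = toRat C p / toRat C q

/-- `W` is a `C(x)`-vector space basis of `A` (represented on coefficient vectors). -/
def IsVSBasis (W : Fin r → (Fin r → RatFunc C)) : Prop :=
  LinearIndependent (RatFunc C) W ∧
    Submodule.span (RatFunc C) (Set.range W) = (⊤ : Submodule (RatFunc C) (Fin r → RatFunc C))

/-- The `C(x)_α`-span of a tuple of elements of `A`. -/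
def localSpan (α : Cbar C) (W : Fin r → (Fin r → RatFunc C)) :
    Set (Fin r → RatFunc C) :=
  {f | ∃ c : Fin r → RatFunc C, (∀ i, InLocalRing C α (c i)) ∧ f = ∑ i, c i • W i}

/-- `W` is a local integral basis of `A` at `α`. -/
def IsLocalIntegralBasis (α : Cbar C) (W : Fin r → (Fin r → RatFunc C)) : Prop :=
  IsVSBasis C r W ∧ (∀ i, IntegralAt C ℓ r α (W i)) ∧
    ∀ f : Fin r → RatFunc C, IntegralAt C ℓ r α f → f ∈ localSpan C r α W

/-- The standard basis `1, S, …, S^{r-1}` of `A`. -/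
def stdBasis : Fin r → (Fin r → RatFunc C) :=
  fun i j => if j = i then 1 else 0

/-- The shift automorphism `p(x) ↦ p(x+c)` of the polynomial ring. -/
def polyShiftEquiv (c : C) : Polynomial C ≃+* Polynomial C where
  toFun p := p.comp (X + Polynomial.C c)
  invFun p := p.comp (X - Polynomial.C c)
  left_inv p := by
    show (p.comp (X + Polynomial.C c)).comp (X - Polynomial.C c) = p
    rw [Polynomial.comp_assoc]; simp
  right_inv p := by
    show (p.comp (X - Polynomial.C c)).comp (X + Polynomial.C c) = p
    rw [Polynomial.comp_assoc]; simp
  map_add' p q := by simp [Polynomial.add_comp]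
  map_mul' p q := by simp [Polynomial.mul_comp]

/-- The shift `σ^k`, `p(x) ↦ p(x+k)`, on polynomials, for `k : ℤ`. -/
def polyShift (k : ℤ) (p : Polynomial C) : Polynomial C := polyShiftEquiv C (k : C) p

/-- `σ` on polynomials. -/
def polyσ : Polynomial C ≃+* Polynomial C := polyShiftEquiv C 1

/-- The shift automorphism `σ : f(x) ↦ f(x+1)` of the rational function field. -/
def ratσ : RatFunc C →+* RatFunc C :=
  RatFunc.mapRingHom (polyσ C : Polynomial C →+* Polynomial C)
    (by
      intro p hp
      simp only [Submonoid.mem_comap]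
      refine mem_nonZeroDivisors_iff_ne_zero.mpr ?_
      have hp0 : p ≠ 0 := mem_nonZeroDivisors_iff_ne_zero.mp hp
      simpa using (map_ne_zero_iff _ (polyσ C).injective).mpr hp0)

variable [NeZero r]

/-- The index `r - 1` as an element of `Fin r`. -/
def lastIdx : Fin r := ⟨r - 1, Nat.sub_lt (Nat.pos_of_ne_zero (NeZero.ne r)) one_pos⟩

/-- The action of `S` on `A = C(x)[S]/⟨L⟩`, on coefficient vectors with respect to the
basis `1, S, …, S^{r-1}`, using `S^r = -(ℓ₀/ℓ_r) - ⋯ - (ℓ_{r-1}/ℓ_r) S^{r-1}`. -/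
def Smap (f : Fin r → RatFunc C) : Fin r → RatFunc C :=
  fun j =>
    (if (j : ℕ) = 0 then 0 else
      ratσ C (f ⟨(j : ℕ) - 1, lt_of_le_of_lt (Nat.sub_le _ _) j.isLt⟩))
      - ratσ C (f (lastIdx r)) * (toRat C (ℓ j) / toRat C (ℓ r))

/-- The difference operator `Δ = S - 1` on `A`. -/
def Dmap (f : Fin r → RatFunc C) : Fin r → RatFunc C :=
  Smap C ℓ r f - f

/-- `f ∈ A` is summable. -/
def IsSummable (f : Fin r → RatFunc C) : Prop :=
  ∃ g : Fin r → RatFunc C, f = Dmap C ℓ r g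

/-- `disp_α(p) ≥ k`: `p` has two roots in `α + ℤ` at distance `k`. -/
def DispGe (α : Cbar C) (p : Polynomial (Cbar C)) (k : ℕ) : Prop :=
  ∃ m : ℤ, Polynomial.eval (α + (m : Cbar C)) p = 0 ∧
    Polynomial.eval (α + (m : Cbar C) + (k : Cbar C)) p = 0

/-- The dispersion `disp_α(p)` as an extended natural number
(`0` by convention for the empty set, which is excluded by the hypotheses below). -/
def dispVal (α : Cbar C) (p : Polynomial (Cbar C)) : ℕ∞ :=
  sSup ((fun k : ℕ => (k : ℕ∞)) '' {k : ℕ | DispGe C α p k})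

/-- A polynomial is shift-free if it is coprime to each of its nontrivial shifts. -/
def ShiftFree {K : Type*} [Field K] [CharZero K] (p : Polynomial K) : Prop :=
  ∀ k : ℤ, k ≠ 0 → IsCoprime p (p.comp (X + Polynomial.C (k : K)))


section Auxiliary

set_option linter.unusedSectionVars false

variable {C r ℓ}

lemma nuq_zero : nuq C 0 = ⊤ := by simp [nuq]

lemma nuq_of_ne {a : LS C} (h : a ≠ 0) : nuq C a = (((a.order : ℤ) : ℝ) : EReal) := by
  simp [nuq, h]

lemma nuq_ne_bot (a : LS C) : nuq C a ≠ ⊥ := by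
  unfold nuq
  split_ifs <;> simp

lemma nuq_add (a b : LS C) : min (nuq C a) (nuq C b) ≤ nuq C (a + b) := by
  by_cases ha : a = 0
  · simp [ha]
  by_cases hb : b = 0
  · simp [hb]
  by_cases hab : a + b = 0
  · simp [hab, nuq_zero]
  rw [nuq_of_ne ha, nuq_of_ne hb, nuq_of_ne hab]
  have h := HahnSeries.min_order_le_order_add hab
  rcases min_le_iff.1 h with h | h
  · exact (min_le_left _ _).trans (by exact_mod_cast h)
  · exact (min_le_right _ _).trans (by exact_mod_cast h)

lemma nuq_mul (a b : LS C) : nuq C (a * b) = nuq C a + nuq C b := by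
  by_cases ha : a = 0
  · simp [ha, nuq_zero, EReal.top_add_of_ne_bot (nuq_ne_bot b)]
  by_cases hb : b = 0
  · simp [hb, nuq_zero, EReal.add_top_of_ne_bot (nuq_ne_bot a)]
  rw [nuq_of_ne ha, nuq_of_ne hb, nuq_of_ne (mul_ne_zero ha hb), HahnSeries.order_mul ha hb]
  push_cast
  rfl

lemma nuq_neg (a : LS C) : nuq C (-a) = nuq C a := by
  by_cases ha : a = 0
  · simp [ha]
  · rw [nuq_of_ne ha, nuq_of_ne (neg_ne_zero.2 ha), HahnSeries.order_neg]

lemma nuq_one : nuq C 1 = 0 := by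
  rw [nuq_of_ne one_ne_zero, HahnSeries.order_one]
  simp

lemma le_nuq_sum {ι : Type*} (s : Finset ι) (g : ι → LS C) (m : EReal)
    (h : ∀ i ∈ s, m ≤ nuq C (g i)) : m ≤ nuq C (∑ i ∈ s, g i) := by
  classical
  induction s using Finset.induction_on with
  | empty => simp [nuq_zero]
  | insert a s ha ih =>
    rw [Finset.sum_insert ha]
    exact (le_min (h a (by simp)) (ih fun i hi => h i (by simp [hi]))).trans (nuq_add _ _)

/-- The expansion in `q` of `p(α + m + q)`, as a polynomial in `q`. -/
def expand (α : Cbar C) (m : ℤ) (p : C[X]) : (Cbar C)[X] :=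
  (p.map (algebraMap C (Cbar C))).comp (X + Polynomial.C (α + (m : Cbar C)))

/-- The value of a polynomial at `α + m + q`. -/
def polyEval (α : Cbar C) (m : ℤ) (p : C[X]) : LS C :=
  p.eval₂ ((algebraMap (Cbar C) (LS C)).comp (algebraMap C (Cbar C)))
    (algebraMap (Cbar C) (LS C) α + (m : LS C) + qv C)

lemma evalAt_toRat (α : Cbar C) (m : ℤ) (p : C[X]) :
    evalAt C α m (toRat C p) = polyEval α m p := by
  unfold evalAt polyEval
  rw [RatFunc.eval_algebraMap]
  simp

lemma evalAt_eq_div (α : Cbar C) (m : ℤ) (f : RatFunc C) :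
    evalAt C α m f = polyEval α m f.num / polyEval α m f.denom := rfl

lemma polyEval_eq_expand (α : Cbar C) (m : ℤ) (p : C[X]) :
    polyEval α m p =
      HahnSeries.ofPowerSeries ℤ (Cbar C) ((expand α m p : (Cbar C)[X]) : PowerSeries (Cbar C)) := by
  have key : polyEval α m p = ((HahnSeries.ofPowerSeries ℤ (Cbar C)).comp
      (Polynomial.coeToPowerSeries.ringHom)) (expand α m p) := by
    unfold expand polyEval
    rw [Polynomial.comp, Polynomial.eval₂_map, Polynomial.hom_eval₂]
    congr 1
    · ext x : 1
      simp [LaurentSeries.algebraMap_apply]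
    · have hm : (((m : ℤ) : (Cbar C)[X]) : PowerSeries (Cbar C)) = m :=
        map_intCast (Polynomial.coeToPowerSeries.ringHom (R := Cbar C)) m
      simp [LaurentSeries.algebraMap_apply, qv, hm]
      ring
  rw [key]
  rfl

lemma polyEval_ne_zero (α : Cbar C) (m : ℤ) {p : C[X]} (hp : p ≠ 0) : polyEval α m p ≠ 0 := by
  rw [polyEval_eq_expand]
  intro h
  rw [map_eq_zero_iff _ HahnSeries.ofPowerSeries_injective, Polynomial.coe_eq_zero_iff] at h
  have h2 : p.map (algebraMap C (Cbar C)) = 0 := by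
    have := congrArg (fun g => g.comp (X - Polynomial.C (α + (m : Cbar C)))) h
    simpa [expand, Polynomial.comp_assoc] using this
  exact hp ((Polynomial.map_eq_zero _).1 h2)

lemma coeff_zero_expand (α : Cbar C) (m : ℤ) (p : C[X]) :
    (expand α m p).coeff 0 = aeval (α + (m : Cbar C)) p := by
  rw [Polynomial.coeff_zero_eq_eval_zero, expand, Polynomial.eval_comp, Polynomial.eval_map]
  simp [Polynomial.aeval_def]

lemma coeff_zero_polyEval (α : Cbar C) (m : ℤ) (p : C[X]) :
    (polyEval α m p).coeff 0 = aeval (α + (m : Cbar C)) p := by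
  rw [polyEval_eq_expand, ← coeff_zero_expand]
  have := HahnSeries.ofPowerSeries_apply_coeff (Γ := ℤ)
    ((expand α m p : (Cbar C)[X]) : PowerSeries (Cbar C)) 0
  simpa using this

lemma coeff_neg_polyEval (α : Cbar C) (m : ℤ) (p : C[X]) {n : ℤ} (hn : n < 0) :
    (polyEval α m p).coeff n = 0 := by
  rw [polyEval_eq_expand, HahnSeries.ofPowerSeries_apply]
  refine HahnSeries.embDomain_of_notMem_range ?_
  rintro ⟨k, hk⟩
  simp at hk
  omega

lemma zero_le_order_polyEval (α : Cbar C) (m : ℤ) {p : C[X]} (hp : p ≠ 0) :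
    0 ≤ (polyEval α m p).order := by
  by_contra! h
  exact HahnSeries.coeff_order_eq_zero.not.2 (polyEval_ne_zero α m hp) (coeff_neg_polyEval α m p h)

lemma zero_le_nuq_polyEval (α : Cbar C) (m : ℤ) (p : C[X]) : 0 ≤ nuq C (polyEval α m p) := by
  by_cases hp : p = 0
  · simp [hp, polyEval, nuq_zero]
  · rw [nuq_of_ne (polyEval_ne_zero α m hp)]
    exact_mod_cast zero_le_order_polyEval α m hp

lemma order_polyEval_eq_zero_iff (α : Cbar C) (m : ℤ) {p : C[X]} (hp : p ≠ 0) :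
    (polyEval α m p).order = 0 ↔ aeval (α + (m : Cbar C)) p ≠ 0 := by
  rw [← coeff_zero_polyEval]
  constructor
  · intro h
    have := HahnSeries.coeff_order_eq_zero.not.2 (polyEval_ne_zero α m hp)
    rwa [h] at this
  · intro h
    exact le_antisymm (HahnSeries.order_le_of_coeff_ne_zero h) (zero_le_order_polyEval α m hp)

lemma nuq_polyEval_eq_zero (α : Cbar C) (m : ℤ) {p : C[X]}
    (h : aeval (α + (m : Cbar C)) p ≠ 0) : nuq C (polyEval α m p) = 0 := by
  have hp : p ≠ 0 := by
    rintro rfl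
    simp at h
  rw [nuq_of_ne (polyEval_ne_zero α m hp), (order_polyEval_eq_zero_iff α m hp).2 h]
  simp

lemma inLocalRing_iff_denom (α : Cbar C) (f : RatFunc C) :
    InLocalRing C α f ↔ aeval α f.denom ≠ 0 := by
  constructor
  · rintro ⟨p, q, hq, rfl⟩ h
    have hq0 : q ≠ 0 := by
      rintro rfl
      simp at hq
    exact hq (Polynomial.aeval_eq_zero_of_dvd_aeval_eq_zero (RatFunc.denom_div_dvd p q) h)
  · intro h
    exact ⟨f.num, f.denom, h, (RatFunc.num_div_denom f).symm⟩

lemma zero_le_nuq_evalAt_iff (α : Cbar C) (f : RatFunc C) :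
    0 ≤ nuq C (evalAt C α 0 f) ↔ InLocalRing C α f := by
  rw [inLocalRing_iff_denom]
  have hd := polyEval_ne_zero α 0 f.denom_ne_zero
  have hmul : polyEval α 0 f.num = evalAt C α 0 f * polyEval α 0 f.denom := by
    rw [evalAt_eq_div, div_mul_cancel₀ _ hd]
  have hdo := order_polyEval_eq_zero_iff α 0 f.denom_ne_zero
  simp only [Int.cast_zero, add_zero] at hdo
  by_cases hf : f.num = 0
  · rw [RatFunc.num_eq_zero_iff] at hf
    subst hf
    simp [evalAt, nuq_zero]
  have hn := polyEval_ne_zero α 0 hf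
  have hno := order_polyEval_eq_zero_iff α 0 hf
  simp only [Int.cast_zero, add_zero] at hno
  have he : evalAt C α 0 f ≠ 0 := fun h => hn (by rw [hmul, h, zero_mul])
  have hord : (polyEval α 0 f.num).order =
      (evalAt C α 0 f).order + (polyEval α 0 f.denom).order := by
    rw [hmul, HahnSeries.order_mul he hd]
  have h1 := zero_le_order_polyEval α 0 hf
  have h2 := zero_le_order_polyEval α 0 f.denom_ne_zero
  have hcop : ¬ (aeval α f.num = 0 ∧ aeval α f.denom = 0) := by
    rintro ⟨ha, hb⟩
    obtain ⟨u, v, huv⟩ := RatFunc.isCoprime_num_denom f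
    have := congrArg (aeval α) huv
    simp [ha, hb] at this
  rw [nuq_of_ne he, ← hdo]
  have : (0 : EReal) ≤ (((evalAt C α 0 f).order : ℝ) : EReal) ↔ 0 ≤ (evalAt C α 0 f).order := by
    norm_cast
  rw [this]
  constructor
  · intro h
    by_contra hne
    have hb : aeval α f.denom = 0 := by
      by_contra hb
      exact hne (hdo.2 hb)
    have := hno.2 fun ha => hcop ⟨ha, hb⟩
    omega
  · intro h
    omega

/-- The sequence with prescribed first `r` terms solving a linear recurrence with
coefficients `c`. -/
def recSeq {K : Type*} [Field K] (r : ℕ) (c : ℕ → ℕ → K) (init : ℕ → K) (n : ℕ) : K :=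
  if n < r then init n
  else -(∑ i : Fin r, c (n - r) i * recSeq r c init (n - r + i)) / c (n - r) r
termination_by n
decreasing_by omega

lemma recSeq_of_lt {K : Type*} [Field K] {r : ℕ} (c : ℕ → ℕ → K) (init : ℕ → K) {n : ℕ}
    (h : n < r) : recSeq r c init n = init n := by
  rw [recSeq, if_pos h]

lemma recSeq_sum {K : Type*} [Field K] (r : ℕ) (c : ℕ → ℕ → K) (init : ℕ → K)
    (hc : ∀ n, c n r ≠ 0) (n : ℕ) :
    ∑ i ∈ Finset.range (r + 1), c n i * recSeq r c init (n + i) = 0 := by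
  rw [Finset.sum_range_succ, recSeq.eq_def r c init (n + r), if_neg (by omega), Nat.add_sub_cancel,
    mul_div_cancel₀ _ (hc n), Finset.sum_range]
  simp

/-- A two-sided linear recurrence of order `r` whose extreme coefficients never vanish has a
solution with any prescribed values on `0, …, r - 1`. -/
lemma exists_two_sided_solution {K : Type*} [Field K] (r : ℕ) (c : ℤ → ℕ → K)
    (h0 : ∀ n, c n 0 ≠ 0) (hr : ∀ n, c n r ≠ 0) (init : ℕ → K) :
    ∃ b : ℤ → K, (∀ i < r, b (i : ℤ) = init i) ∧
      ∀ n : ℤ, ∑ i ∈ Finset.range (r + 1), c n i * b (n + i) = 0 := by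
  set a := recSeq r (fun n i => c n i) init with ha
  set d := recSeq r (fun n i => c (-1 - (n : ℤ)) (r - i)) (fun i => init (r - 1 - i)) with hd
  let b : ℤ → K := fun m => if 0 ≤ m then a m.toNat else d (r - 1 - m).toNat
  have hba : ∀ m : ℤ, 0 ≤ m → b m = a m.toNat := fun m hm => if_pos hm
  have hbd : ∀ m : ℤ, m < r → b m = d (r - 1 - m).toNat := by
    intro m hm
    by_cases h : 0 ≤ m
    · rw [hba m h, ha, hd, recSeq_of_lt _ _ (by omega), recSeq_of_lt _ _ (by omega)]
      congr 1
      omega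
    · exact if_neg h
  refine ⟨b, ?_, fun n => ?_⟩
  · intro i hi
    rw [hba _ (by omega), Int.toNat_natCast, ha, recSeq_of_lt _ _ hi]
  · by_cases hn : 0 ≤ n
    · lift n to ℕ using hn
      rw [← recSeq_sum r (fun n i => c n i) init (fun n => hr n) n]
      refine Finset.sum_congr rfl fun i _ => ?_
      rw [hba _ (by omega)]
      congr 2
    · obtain ⟨k, rfl⟩ : ∃ k : ℕ, n = -1 - (k : ℤ) := ⟨(-1 - n).toNat, by omega⟩
      rw [← recSeq_sum r (fun n i => c (-1 - (n : ℤ)) (r - i)) (fun i => init (r - 1 - i))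
        (fun n => by simpa using h0 _) k, ← Finset.sum_range_reflect]
      refine Finset.sum_congr rfl fun i hi => ?_
      have hi' : i ≤ r := by
        have := Finset.mem_range.1 hi
        omega
      have e : r + 1 - 1 - i = r - i := by omega
      rw [e, hbd _ (by omega), hd]
      congr 2
      omega

/-- The minimal valuation of the values `b k, …, b (k + r - 1)`. -/
def windowVal (r : ℕ) (b : ℤ → LS C) (k : ℤ) : EReal := ⨅ i : Fin r, nuq C (b (k + (i : ℤ)))

lemma windowVal_le (b : ℤ → LS C) (k : ℤ) {i : ℕ} (hi : i < r) :
    windowVal r b k ≤ nuq C (b (k + (i : ℤ))) :=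
  iInf_le (fun i : Fin r => nuq C (b (k + (i : ℤ)))) ⟨i, hi⟩

lemma le_nuq_of_add_eq_zero {m : EReal} {c x s : LS C} (hc : nuq C c = 0)
    (h : s + c * x = 0) (hs : m ≤ nuq C s) : m ≤ nuq C x := by
  have h1 : nuq C (c * x) = nuq C s := by
    rw [eq_neg_of_add_eq_zero_right h, nuq_neg]
  rw [nuq_mul, hc, zero_add] at h1
  rwa [h1]

lemma le_nuq_mul_of_nonneg {m : EReal} {c x : LS C} (hc : 0 ≤ nuq C c) (hx : m ≤ nuq C x) :
    m ≤ nuq C (c * x) := by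
  rw [nuq_mul]
  simpa using add_le_add hc hx

lemma windowVal_succ {η : Cbar C} {b : ℤ → LS C} (hb : b ∈ SolSet C ℓ r η) {k : ℤ}
    (h0 : aeval (η + (k : Cbar C)) (ℓ 0) ≠ 0) (hr : aeval (η + (k : Cbar C)) (ℓ r) ≠ 0) :
    windowVal r b k = windowVal r b (k + 1) := by
  have hrec := hb k
  simp only [evalAt_toRat] at hrec
  apply le_antisymm
  · refine le_iInf fun i => ?_
    by_cases hi : (i : ℕ) + 1 < r
    · have := windowVal_le b k hi
      rwa [show k + 1 + (i : ℤ) = k + ((i + 1 : ℕ) : ℤ) by push_cast; ring]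
    · rw [show k + 1 + (i : ℤ) = k + (r : ℤ) by have := i.2; omega]
      rw [Finset.sum_range_succ] at hrec
      refine le_nuq_of_add_eq_zero (nuq_polyEval_eq_zero η k hr) hrec (le_nuq_sum _ _ _ ?_)
      intro j hj
      exact le_nuq_mul_of_nonneg (zero_le_nuq_polyEval _ _ _)
        (windowVal_le b k (Finset.mem_range.1 hj))
  · refine le_iInf fun i => ?_
    by_cases hi : (i : ℕ) = 0
    · rw [hi]
      rw [Finset.sum_range_succ'] at hrec
      refine le_nuq_of_add_eq_zero (nuq_polyEval_eq_zero η k h0) hrec (le_nuq_sum _ _ _ ?_)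
      intro j hj
      refine le_nuq_mul_of_nonneg (zero_le_nuq_polyEval _ _ _) ?_
      have := windowVal_le b (k + 1) (Finset.mem_range.1 hj)
      rwa [show k + ((j + 1 : ℕ) : ℤ) = k + 1 + (j : ℤ) by push_cast; ring]
    · have := windowVal_le b (k + 1) (show (i : ℕ) - 1 < r by have := i.2; omega)
      rwa [show k + 1 + (((i : ℕ) - 1 : ℕ) : ℤ) = k + (i : ℤ) by omega] at this

lemma liminf_nuq_eq_windowVal {η : Cbar C} {b : ℤ → LS C} (hb : b ∈ SolSet C ℓ r η)
    (hroots : ∀ k : ℤ, k < 0 → aeval (η + (k : Cbar C)) (ℓ 0 * ℓ r) ≠ 0) :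
    Filter.liminf (fun n : ℕ => nuq C (b (-(n : ℤ)))) Filter.atTop = windowVal r b 0 := by
  have hW : ∀ n : ℕ, windowVal r b (-(n : ℤ)) = windowVal r b 0 := by
    intro n
    induction n with
    | zero => simp
    | succ n ih =>
      have h := hroots (-((n + 1 : ℕ) : ℤ)) (by omega)
      rw [map_mul] at h
      rw [windowVal_succ hb (left_ne_zero_of_mul h) (right_ne_zero_of_mul h), ← ih]
      congr 1
      omega
  apply le_antisymm
  · refine Filter.liminf_le_of_frequently_le' (Filter.frequently_atTop.2 fun n => ?_)
    obtain ⟨i, hi⟩ := exists_eq_ciInf_of_finite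
      (f := fun i : Fin r => nuq C (b (-((n + r : ℕ) : ℤ) + (i : ℤ))))
    refine ⟨n + r - i, by have := i.2; omega, le_of_eq ?_⟩
    rw [← hW (n + r), windowVal, ← hi]
    congr 2
    have := i.2
    omega
  · refine Filter.le_liminf_of_le (by isBoundedDefault) (Filter.Eventually.of_forall fun n => ?_)
    rw [← hW n]
    simpa using windowVal_le b (-(n : ℤ)) (Nat.pos_of_ne_zero (NeZero.ne r))

lemma windowVal_ne_bot (b : ℤ → LS C) (k : ℤ) : windowVal r b k ≠ ⊥ := by
  obtain ⟨i, hi⟩ := exists_eq_ciInf_of_finite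
    (f := fun i : Fin r => nuq C (b (k + (i : ℤ))))
  rw [windowVal, ← hi]
  exact nuq_ne_bot _

lemma iInf_le_valAt {η : Cbar C}
    (hroots : ∀ k : ℤ, k < 0 → aeval (η + (k : Cbar C)) (ℓ 0 * ℓ r) ≠ 0)
    (f : Fin r → RatFunc C) :
    ⨅ j : Fin r, nuq C (evalAt C η 0 (f j)) ≤ valAt C ℓ r η f := by
  refine le_iInf₂ fun b hb => ?_
  rw [liminf_nuq_eq_windowVal hb hroots, esub]
  split_ifs with h
  · exact le_top
  · rw [EReal.le_sub_iff_add_le (Or.inl (windowVal_ne_bot b 0)) (Or.inl h)]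
    refine le_nuq_sum _ _ _ fun i _ => ?_
    rw [nuq_mul]
    exact add_le_add (iInf_le _ i) (windowVal_le b 0 i.2)

lemma valAt_le (hℓ : ℓ 0 * ℓ r ≠ 0) {η : Cbar C}
    (hroots : ∀ k : ℤ, k < 0 → aeval (η + (k : Cbar C)) (ℓ 0 * ℓ r) ≠ 0)
    (f : Fin r → RatFunc C) (j : Fin r) :
    valAt C ℓ r η f ≤ nuq C (evalAt C η 0 (f j)) := by
  obtain ⟨b, hinit, hrec⟩ := exists_two_sided_solution r (fun n i => polyEval η n (ℓ i))
    (fun n => polyEval_ne_zero η n (left_ne_zero_of_mul hℓ))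
    (fun n => polyEval_ne_zero η n (right_ne_zero_of_mul hℓ))
    (fun i => if i = (j : ℕ) then 1 else 0)
  have hb : b ∈ SolSet C ℓ r η := fun n => by simpa only [evalAt_toRat] using hrec n
  have hw : windowVal r b 0 = 0 := by
    apply le_antisymm
    · refine (windowVal_le b 0 j.2).trans (le_of_eq ?_)
      rw [zero_add, hinit _ j.2, if_pos rfl, nuq_one]
    · refine le_iInf fun i => ?_
      rw [zero_add, hinit _ i.2]
      split_ifs
      · rw [nuq_one]
      · rw [nuq_zero]
        exact le_top
  have hval : elemApply C r η f b 0 = evalAt C η 0 (f j) := by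
    unfold elemApply
    rw [Finset.sum_eq_single j]
    · rw [zero_add, hinit _ j.2, if_pos rfl, mul_one]
    · intro i _ hij
      rw [zero_add, hinit _ i.2, if_neg (fun h => hij (Fin.ext h)), mul_zero]
    · simp
  refine (iInf₂_le b hb).trans (le_of_eq ?_)
  rw [liminf_nuq_eq_windowVal hb hroots, hw, hval, esub, if_neg EReal.zero_ne_top, sub_zero]

end Auxiliary

theorem statement3 (hr : 1 ≤ r) (hℓ : ℓ 0 * ℓ r ≠ 0) (η : Cbar C)
    (hroots : ∀ k : ℤ, k < 0 → (Polynomial.aeval (η + (k : Cbar C))) (ℓ 0 * ℓ r) ≠ 0)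
    (f : Fin r → RatFunc C) :
    (valAt C ℓ r η f = ⨅ j : Fin r, nuq C (evalAt C η 0 (f j))) ∧
      (IntegralAt C ℓ r η f ↔ ∀ j : Fin r, InLocalRing C η (f j)) := by
  have hval : valAt C ℓ r η f = ⨅ j : Fin r, nuq C (evalAt C η 0 (f j)) :=
    le_antisymm (le_iInf fun j => valAt_le hℓ hroots f j) (iInf_le_valAt hroots f)
  refine ⟨hval, ?_⟩
  rw [IntegralAt, hval, le_iInf_iff]
  exact forall_congr' fun j => zero_le_nuq_evalAt_iff η (f j)

end PRec
end
end

section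
/- Let W = (ω₁,…,ω_r) be a C(x)-basis of A and α ∈ C̄. Let f = (1/u)·aW and g = (1/v)·bW with a = (a₁,…,a_r), b = (b₁,…,b_r) ∈ C[x]^r and nonzero u, v ∈ C[x] satisfying gcd(a₁,…,a_r,u) = 1 and gcd(b₁,…,b_r,v) = 1. Suppose f = Δg and disp_α(v) ≥ 0. If W is a local integral basis of A at the whole orbit α+ℤ, then disp_α(u) ≥ disp_α(v) + 1. -/
set_option maxHeartbeats 1000000
set_option synthInstance.maxHeartbeats 200000

open Polynomial Filter

noncomputable section

namespace PRec

variable (C : Type*) [Field C] [CharZero C]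

variable (ℓ : ℕ → Polynomial C) (r : ℕ)

variable [NeZero r]

section Translation

variable {C : Type*} [Field C] {ℓ : ℕ → Polynomial C} {r : ℕ}

theorem evalAt_add_one (α : Cbar C) (m : ℤ) (p : RatFunc C) :
    evalAt C (α + 1) m p = evalAt C α (m + 1) p := by
  unfold evalAt
  congr 1
  simp
  ring

theorem shift_mem_SolSet {α : Cbar C} {b : ℤ → LS C} :
    (fun n => b (n + 1)) ∈ SolSet C ℓ r (α + 1) ↔ b ∈ SolSet C ℓ r α := by
  have h (n : ℤ) : ∑ i ∈ Finset.range (r + 1),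
      evalAt C (α + 1) n (toRat C (ℓ i)) * b (n + i + 1)
      = ∑ i ∈ Finset.range (r + 1),
        evalAt C α (n + 1) (toRat C (ℓ i)) * b (n + 1 + i) := by
    simp only [evalAt_add_one, add_right_comm]
  constructor
  · intro hb n
    have := hb (n - 1)
    rwa [h, sub_add_cancel] at this
  · intro hb n
    exact (h n).trans (hb (n + 1))

end Translation

section Evaluation

variable {C : Type*} [Field C]

theorem eval₂_qv_ne_zero (β : Cbar C) {p : Polynomial (Cbar C)} (hp : p ≠ 0) :
    p.eval₂ (algebraMap (Cbar C) (LS C)) (algebraMap (Cbar C) (LS C) β + qv C) ≠ 0 := by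
  set P := p.comp (X + Polynomial.C β) with hP
  have hP0 : P ≠ 0 := fun h => hp <| by
    have h' : (p.comp (X + Polynomial.C β)).comp (X - Polynomial.C β) = 0 := by
      rw [← hP, h, zero_comp]
    rw [comp_assoc] at h'
    simpa using h'
  have hφ : algebraMap (Cbar C) (LS C)
      = (HahnSeries.ofPowerSeries ℤ (Cbar C)).comp (PowerSeries.C (R := Cbar C)) := by
    ext1 c
    rw [RingHom.comp_apply, HahnSeries.algebraMap_apply', PowerSeries.algebraMap_apply]
    rfl
  have hq : qv C = HahnSeries.ofPowerSeries ℤ (Cbar C) PowerSeries.X := by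
    rw [HahnSeries.ofPowerSeries_X, qv]
  have key : p.eval₂ (algebraMap (Cbar C) (LS C)) (algebraMap (Cbar C) (LS C) β + qv C)
      = HahnSeries.ofPowerSeries ℤ (Cbar C) (P : PowerSeries (Cbar C)) := by
    rw [← Polynomial.eval₂_C_X_eq_coe, Polynomial.hom_eval₂, ← hφ, ← hq, hP,
      Polynomial.eval₂_comp]
    congr 1
    simp [add_comm]
  rw [key, Ne, map_eq_zero_iff _ HahnSeries.ofPowerSeries_injective]
  simpa using hP0

/-- Evaluation of polynomials at `α + m + q`. -/
def polyEvalAt (α : Cbar C) (m : ℤ) : Polynomial C →+* LS C :=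
  Polynomial.eval₂RingHom ((algebraMap (Cbar C) (LS C)).comp (algebraMap C (Cbar C)))
    (algebraMap (Cbar C) (LS C) α + (m : LS C) + qv C)

theorem polyEvalAt_ne_zero (α : Cbar C) (m : ℤ) {p : Polynomial C} (hp : p ≠ 0) :
    polyEvalAt α m p ≠ 0 := by
  have h := eval₂_qv_ne_zero (α + (m : Cbar C))
    ((Polynomial.map_ne_zero_iff (algebraMap C (Cbar C)).injective).mpr hp)
  rw [Polynomial.eval₂_map, map_add, map_intCast] at h
  exact h

/-- `evalAt` as a ring homomorphism. -/
def evalAtHom (α : Cbar C) (m : ℤ) : RatFunc C →+* LS C :=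
  IsLocalization.lift (M := nonZeroDivisors (Polynomial C)) (g := polyEvalAt α m)
    fun y => (polyEvalAt_ne_zero α m (nonZeroDivisors.ne_zero y.2)).isUnit

theorem evalAtHom_toRat (α : Cbar C) (m : ℤ) (p : Polynomial C) :
    evalAtHom α m (toRat C p) = polyEvalAt α m p :=
  IsLocalization.lift_eq _ _

theorem evalAt_eq (α : Cbar C) (m : ℤ) (p : RatFunc C) :
    evalAt C α m p = evalAtHom α m p := by
  conv_rhs => rw [← RatFunc.num_div_denom p]
  rw [map_div₀, evalAtHom_toRat, evalAtHom_toRat]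
  rfl

theorem ratσ_toRat (p : Polynomial C) :
    ratσ C (toRat C p) = toRat C (p.comp (X + 1)) := by
  have h : ratσ C (toRat C p / toRat C 1) = toRat C (polyσ C p) / toRat C (polyσ C 1) :=
    RatFunc.map_apply_div (polyσ C : Polynomial C →+* Polynomial C)
      (nonZeroDivisors_le_comap_nonZeroDivisors_of_injective _ (polyσ C).injective) p 1
  rw [map_one, map_one, map_one, div_one, div_one] at h
  rw [h, polyσ, polyShiftEquiv]
  simp

theorem ratσ_surjective : Function.Surjective (ratσ C) := by
  intro f
  have hp (p : Polynomial C) : ratσ C (toRat C (p.comp (X - 1))) = toRat C p := by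
    rw [ratσ_toRat, comp_assoc]; simp
  refine ⟨toRat C (f.num.comp (X - 1)) / toRat C (f.denom.comp (X - 1)), ?_⟩
  rw [map_div₀, hp, hp, RatFunc.num_div_denom]

theorem evalAt_ratσ (α : Cbar C) (m : ℤ) (p : RatFunc C) :
    evalAt C α m (ratσ C p) = evalAt C α (m + 1) p := by
  rw [evalAt_eq, evalAt_eq, ← RatFunc.num_div_denom p]
  simp only [map_div₀, ratσ_toRat, evalAtHom_toRat]
  have h (p : Polynomial C) : polyEvalAt α m (p.comp (X + 1)) = polyEvalAt α (m + 1) p := by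
    simp only [polyEvalAt, coe_eval₂RingHom, eval₂_comp]
    congr 1
    simp
    ring
  rw [h, h]

end Evaluation

section LocalRing

variable {C : Type*} [Field C]

/-- The local ring `C(x)_α` as a subring of `C(x)`. -/
def localSubring (α : Cbar C) : Subring (RatFunc C) where
  carrier := {f | InLocalRing C α f}
  mul_mem' := by
    rintro _ _ ⟨p, q, hq, rfl⟩ ⟨p', q', hq', rfl⟩
    refine ⟨p * p', q * q', ?_, ?_⟩
    · simp [hq, hq']
    · rw [map_mul, map_mul, div_mul_div_comm]
  one_mem' := ⟨1, 1, by simp, by simp⟩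
  add_mem' := by
    rintro _ _ ⟨p, q, hq, rfl⟩ ⟨p', q', hq', rfl⟩
    have h : ∀ q : Polynomial C, aeval α q ≠ 0 → toRat C q ≠ 0 := fun q hq h0 => hq <| by
      rw [(map_eq_zero_iff _ (RatFunc.algebraMap_injective C)).mp h0, map_zero]
    refine ⟨p * q' + q * p', q * q', ?_, ?_⟩
    · simp [hq, hq']
    · rw [div_add_div _ _ (h q hq) (h q' hq')]
      simp only [map_add, map_mul]
  zero_mem' := ⟨0, 1, by simp, by simp⟩
  neg_mem' := by
    rintro _ ⟨p, q, hq, rfl⟩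
    exact ⟨-p, q, hq, by rw [map_neg, neg_div]⟩

theorem ratσ_mem_localSubring {α : Cbar C} {f : RatFunc C} (hf : f ∈ localSubring (α + 1)) :
    ratσ C f ∈ localSubring α := by
  obtain ⟨p, q, hq, rfl⟩ := hf
  refine ⟨p.comp (X + 1), q.comp (X + 1), ?_, ?_⟩
  · simpa [aeval_comp] using hq
  · rw [map_div₀, ratσ_toRat, ratσ_toRat]

theorem exists_ratσ_eq {α : Cbar C} {f : RatFunc C} (hf : f ∈ localSubring α) :
    ∃ f' ∈ localSubring (α + 1), ratσ C f' = f := by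
  obtain ⟨p, q, hq, rfl⟩ := hf
  have hp (p : Polynomial C) : ratσ C (toRat C (p.comp (X - 1))) = toRat C p := by
    rw [ratσ_toRat, comp_assoc]; simp
  refine ⟨toRat C (p.comp (X - 1)) / toRat C (q.comp (X - 1)),
    ⟨p.comp (X - 1), q.comp (X - 1), ?_, rfl⟩, ?_⟩
  · simpa [aeval_comp] using hq
  · rw [map_div₀, hp, hp]

variable {r : ℕ}

/-- The `C(x)_α`-span of `W` as a submodule over the local ring. -/
def localSpanSubmodule (α : Cbar C) (W : Fin r → (Fin r → RatFunc C)) :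
    Submodule (localSubring α) (Fin r → RatFunc C) where
  carrier := localSpan C r α W
  add_mem' := by
    rintro _ _ ⟨c, hc, rfl⟩ ⟨d, hd, rfl⟩
    exact ⟨c + d, fun i => (localSubring α).add_mem (hc i) (hd i),
      by simp [add_smul, Finset.sum_add_distrib]⟩
  zero_mem' := ⟨0, fun _ => (localSubring α).zero_mem, by simp⟩
  smul_mem' := by
    rintro ⟨a, ha⟩ _ ⟨c, hc, rfl⟩
    refine ⟨fun i => a * c i, fun i => (localSubring α).mul_mem ha (hc i), ?_⟩
    rw [Subring.smul_def, Finset.smul_sum]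
    simp only [mul_smul]

theorem smul_mem_localSpanSubmodule {α : Cbar C} {W : Fin r → (Fin r → RatFunc C)}
    {c : RatFunc C} (hc : c ∈ localSubring α) {f : Fin r → RatFunc C}
    (hf : f ∈ localSpanSubmodule α W) : c • f ∈ localSpanSubmodule α W :=
  (localSpanSubmodule α W).smul_mem ⟨c, hc⟩ hf

theorem inv_smul_sum_mem_localSpanSubmodule {α : Cbar C} {W : Fin r → (Fin r → RatFunc C)}
    (b : Fin r → Polynomial C) {v : Polynomial C} (hv : aeval α v ≠ 0) :
    (toRat C v)⁻¹ • ∑ i, toRat C (b i) • W i ∈ localSpanSubmodule α W := by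
  refine ⟨fun i => toRat C (b i) / toRat C v, fun i => ⟨b i, v, hv, rfl⟩, ?_⟩
  rw [Finset.smul_sum]
  simp only [smul_smul, div_eq_inv_mul]

theorem inv_smul_sum_notMem_localSpanSubmodule {α : Cbar C} {W : Fin r → (Fin r → RatFunc C)}
    (hW : LinearIndependent (RatFunc C) W) (b : Fin r → Polynomial C) {v : Polynomial C}
    (hv0 : v ≠ 0) (hgcd : ∀ d : Polynomial C, d ∣ v → (∀ i, d ∣ b i) → IsUnit d)
    (hv : aeval α v = 0) :
    (toRat C v)⁻¹ • ∑ i, toRat C (b i) • W i ∉ localSpanSubmodule α W := by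
  rintro ⟨c, hc, h⟩
  have hint : IsIntegral C α := Algebra.IsIntegral.isIntegral α
  refine (minpoly.irreducible hint).not_isUnit
    (hgcd _ (minpoly.dvd C α hv) fun i => minpoly.dvd C α ?_)
  have hvR : toRat C v ≠ 0 := (map_ne_zero_iff _ (RatFunc.algebraMap_injective C)).mpr hv0
  have hci : (toRat C v)⁻¹ * toRat C (b i) = c i := by
    refine hW.eq_coords_of_eq (f := fun i => (toRat C v)⁻¹ * toRat C (b i)) (g := c) ?_ i
    rw [← h, Finset.smul_sum]
    simp only [smul_smul]
  obtain ⟨p, q, hq, hpq⟩ := hc i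
  have hqR : toRat C q ≠ 0 := fun h0 => hq <| by
    rw [(map_eq_zero_iff _ (RatFunc.algebraMap_injective C)).mp h0, map_zero]
  rw [hpq, inv_mul_eq_div, div_eq_div_iff hvR hqR, ← map_mul, ← map_mul] at hci
  have := congrArg (aeval α) (RatFunc.algebraMap_injective C hci)
  rw [map_mul, map_mul, hv, mul_zero] at this
  exact (mul_eq_zero.mp this).resolve_right hq

end LocalRing

section Shift

variable {C : Type*} [Field C] {ℓ : ℕ → Polynomial C} {r : ℕ} [NeZero r]

theorem Smap_smul (c : RatFunc C) (f : Fin r → RatFunc C) :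
    Smap C ℓ r (c • f) = ratσ C c • Smap C ℓ r f := by
  ext j
  simp only [Smap, Pi.smul_apply, smul_eq_mul, map_mul]
  split_ifs <;> ring

variable (C ℓ r) in
/-- `Smap` as an additive homomorphism. -/
def SmapHom : (Fin r → RatFunc C) →+ (Fin r → RatFunc C) where
  toFun := Smap C ℓ r
  map_zero' := by ext j; simp [Smap]
  map_add' f g := by
    ext j
    simp only [Smap, Pi.add_apply, map_add]
    split_ifs <;> ring

theorem Smap_sum_smul {ι : Type*} (s : Finset ι) (c : ι → RatFunc C)
    (f : ι → (Fin r → RatFunc C)) :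
    Smap C ℓ r (∑ i ∈ s, c i • f i) = ∑ i ∈ s, ratσ C (c i) • Smap C ℓ r (f i) := by
  simp only [← Smap_smul]
  exact map_sum (SmapHom C ℓ r) _ s

theorem Smap_injective (hℓ : ℓ 0 * ℓ r ≠ 0) : Function.Injective (Smap C ℓ r) := by
  refine (injective_iff_map_eq_zero (SmapHom C ℓ r)).mpr fun f hf => ?_
  have hf' (j : Fin r) : Smap C ℓ r f j = 0 := congrFun hf j
  have hR {p : Polynomial C} (hp : p ≠ 0) : toRat C p ≠ 0 :=
    (map_ne_zero_iff _ (RatFunc.algebraMap_injective C)).mpr hp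
  have hlast : ratσ C (f (lastIdx r)) = 0 := by
    have h0 := hf' ⟨0, Nat.pos_of_ne_zero (NeZero.ne r)⟩
    simpa [Smap, hR (left_ne_zero_of_mul hℓ), hR (right_ne_zero_of_mul hℓ)] using h0
  ext i
  refine (map_eq_zero (ratσ C)).mp ?_
  by_cases hi : (i : ℕ) + 1 < r
  · simpa [Smap, hlast] using hf' ⟨i + 1, hi⟩
  · rwa [show i = lastIdx r from Fin.ext (by simp only [lastIdx]; omega)]

theorem Smap_surjective (hℓ : ℓ 0 * ℓ r ≠ 0) : Function.Surjective (Smap C ℓ r) := by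
  intro f
  have hR {p : Polynomial C} (hp : p ≠ 0) : toRat C p ≠ 0 :=
    (map_ne_zero_iff _ (RatFunc.algebraMap_injective C)).mpr hp
  have h0 := hR (left_ne_zero_of_mul hℓ)
  have h1 := hR (right_ne_zero_of_mul hℓ)
  set t : RatFunc C :=
    -(f ⟨0, Nat.pos_of_ne_zero (NeZero.ne r)⟩ * toRat C (ℓ r) / toRat C (ℓ 0)) with ht
  have hg (i : Fin r) : ∃ y : RatFunc C, ratσ C y = if hi : (i : ℕ) + 1 < r then
      f ⟨i + 1, hi⟩ + t * (toRat C (ℓ (i + 1)) / toRat C (ℓ r)) else t := ratσ_surjective _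
  choose g hg using hg
  have hlast : ratσ C (g (lastIdx r)) = t := by
    rw [hg, dif_neg]
    simp only [lastIdx]
    omega
  refine ⟨g, funext fun j => ?_⟩
  obtain ⟨_ | j, hj⟩ := j
  · simp only [Smap, hlast, ht, if_true]
    field_simp
    ring
  · simp [Smap, hlast, hg, hj]

theorem elemApply_Smap (hℓ : ℓ 0 * ℓ r ≠ 0) {α : Cbar C} (f : Fin r → RatFunc C)
    {b : ℤ → LS C} (hb : b ∈ SolSet C ℓ r α) (n : ℤ) :
    elemApply C r α (Smap C ℓ r f) b n = elemApply C r α f b (n + 1) := by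
  have hlr : evalAt C α n (toRat C (ℓ r)) ≠ 0 := by
    rw [evalAt_eq, evalAtHom_toRat]
    exact polyEvalAt_ne_zero α n (right_ne_zero_of_mul hℓ)
  have hs := hb n
  obtain ⟨s, rfl⟩ := Nat.exists_eq_succ_of_ne_zero (NeZero.ne r)
  have hlast : lastIdx (s + 1) = Fin.last s := rfl
  have hcoef (j : Fin (s + 1)) : evalAt C α n (Smap C ℓ (s + 1) f j)
      = (if (j : ℕ) = 0 then 0 else
          evalAt C α (n + 1) (f ⟨(j : ℕ) - 1, lt_of_le_of_lt (Nat.sub_le _ _) j.isLt⟩))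
        - evalAt C α (n + 1) (f (Fin.last s)) *
          (evalAt C α n (toRat C (ℓ j)) / evalAt C α n (toRat C (ℓ (s + 1)))) := by
    simp only [← evalAt_ratσ]
    simp only [evalAt_eq, Smap, map_sub, map_mul, map_div₀, hlast]
    split_ifs <;> simp only [map_zero]
  have hsum : ∑ j : Fin (s + 1), evalAt C α n (toRat C (ℓ j)) * b (n + (j : ℤ))
      = -(evalAt C α n (toRat C (ℓ (s + 1))) * b (n + ((s + 1 : ℕ) : ℤ))) := by
    rw [Finset.sum_range_succ] at hs
    rw [Fin.sum_univ_eq_sum_range (fun j => evalAt C α n (toRat C (ℓ j)) * b (n + (j : ℤ)))]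
    exact eq_neg_of_add_eq_zero_left hs
  simp only [elemApply, hcoef, sub_mul, Finset.sum_sub_distrib]
  have h2 : ∑ j : Fin (s + 1), evalAt C α (n + 1) (f (Fin.last s)) *
      (evalAt C α n (toRat C (ℓ j)) / evalAt C α n (toRat C (ℓ (s + 1)))) * b (n + (j : ℤ))
      = -(evalAt C α (n + 1) (f (Fin.last s)) * b (n + ((s + 1 : ℕ) : ℤ))) := by
    have : ∀ j : Fin (s + 1), evalAt C α (n + 1) (f (Fin.last s)) *
        (evalAt C α n (toRat C (ℓ j)) / evalAt C α n (toRat C (ℓ (s + 1)))) * b (n + (j : ℤ))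
        = evalAt C α (n + 1) (f (Fin.last s)) / evalAt C α n (toRat C (ℓ (s + 1))) *
          (evalAt C α n (toRat C (ℓ j)) * b (n + (j : ℤ))) := fun j => by ring
    simp only [this]
    rw [← Finset.mul_sum, hsum]
    field_simp
  rw [h2, Fin.sum_univ_succ, Fin.sum_univ_castSucc (n := s)]
  simp [Fin.castSucc, Fin.castAdd, Fin.castLE, add_assoc, add_comm (1 : ℤ)]

theorem valAt_Smap (hℓ : ℓ 0 * ℓ r ≠ 0) (α : Cbar C) (f : Fin r → RatFunc C) :
    valAt C ℓ r α (Smap C ℓ r f) = valAt C ℓ r (α + 1) f := by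
  have key (b : ℤ → LS C) (hb : b ∈ SolSet C ℓ r α) :
      esub (nuq C (elemApply C r α (Smap C ℓ r f) b 0))
        (liminf (fun n : ℕ => nuq C (b (-(n : ℤ)))) atTop)
      = esub (nuq C (elemApply C r (α + 1) f (fun n => b (n + 1)) 0))
        (liminf (fun n : ℕ => nuq C (b (-(n : ℤ) + 1))) atTop) := by
    congr 1
    · rw [elemApply_Smap hℓ f hb]
      simp only [elemApply, evalAt_add_one, add_right_comm]
    · rw [← liminf_nat_add (fun n : ℕ => nuq C (b (-(n : ℤ) + 1))) 1]
      simp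
  unfold valAt
  refine le_antisymm (le_iInf₂ fun b hb => ?_) (le_iInf₂ fun b hb => ?_)
  · have hb' : (fun n => b (n - 1)) ∈ SolSet C ℓ r α := by
      rw [← shift_mem_SolSet]
      simpa using hb
    refine (iInf₂_le _ hb').trans ((key _ hb').trans ?_).le
    simp
  · exact (iInf₂_le _ (shift_mem_SolSet.mpr hb)).trans (key b hb).ge

theorem integralAt_Smap (hℓ : ℓ 0 * ℓ r ≠ 0) {α : Cbar C} {f : Fin r → RatFunc C} :
    IntegralAt C ℓ r α (Smap C ℓ r f) ↔ IntegralAt C ℓ r (α + 1) f := by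
  rw [IntegralAt, valAt_Smap hℓ, IntegralAt]

theorem Smap_mem_localSpanSubmodule_iff (hℓ : ℓ 0 * ℓ r ≠ 0) {α : Cbar C}
    {W : Fin r → (Fin r → RatFunc C)} (hW : IsLocalIntegralBasis C ℓ r α W)
    (hW' : IsLocalIntegralBasis C ℓ r (α + 1) W) {f : Fin r → RatFunc C} :
    Smap C ℓ r f ∈ localSpanSubmodule α W ↔ f ∈ localSpanSubmodule (α + 1) W := by
  constructor
  · rintro ⟨c, hc, h⟩
    choose c' hc' hcc' using fun i => exists_ratσ_eq (hc i)
    choose w hw using fun i => Smap_surjective hℓ (W i)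
    have hf : f = ∑ i, c' i • w i := Smap_injective hℓ <| by
      rw [Smap_sum_smul, h]
      simp only [hcc', hw]
    rw [hf]
    refine Submodule.sum_mem _ fun i _ => smul_mem_localSpanSubmodule (hc' i) ?_
    refine hW'.2.2 _ ((integralAt_Smap hℓ).mp ?_)
    rw [hw]
    exact hW.2.1 i
  · rintro ⟨c, hc, rfl⟩
    rw [Smap_sum_smul]
    exact Submodule.sum_mem _ fun i _ => smul_mem_localSpanSubmodule
      (ratσ_mem_localSubring (hc i)) (hW.2.2 _ ((integralAt_Smap hℓ).mpr (hW'.2.1 i)))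

end Shift

theorem statement7 [NeZero r] (hr : 1 ≤ r) (hℓ : ℓ 0 * ℓ r ≠ 0)
    (W : Fin r → (Fin r → RatFunc C)) (hWb : IsVSBasis C r W) (α : Cbar C)
    (a b : Fin r → Polynomial C) (u v : Polynomial C) (hu : u ≠ 0) (hv : v ≠ 0)
    (hgcdu : ∀ d : Polynomial C, d ∣ u → (∀ i, d ∣ a i) → IsUnit d)
    (hgcdv : ∀ d : Polynomial C, d ∣ v → (∀ i, d ∣ b i) → IsUnit d)
    (hfg : (toRat C u)⁻¹ • (∑ i, toRat C (a i) • W i)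
      = Dmap C ℓ r ((toRat C v)⁻¹ • ∑ i, toRat C (b i) • W i))
    (hdisp : DispGe C α (v.map (algebraMap C (Cbar C))) 0)
    (hW : ∀ m : ℤ, IsLocalIntegralBasis C ℓ r (α + (m : Cbar C)) W) :
    dispVal C α (v.map (algebraMap C (Cbar C))) + 1
      ≤ dispVal C α (u.map (algebraMap C (Cbar C))) := by
  set g := (toRat C v)⁻¹ • ∑ i, toRat C (b i) • W i with hg
  set f := (toRat C u)⁻¹ • ∑ i, toRat C (a i) • W i with hf
  have heval (p : Polynomial C) (x : Cbar C) :
      Polynomial.eval x (p.map (algebraMap C (Cbar C))) = aeval x p := by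
    rw [eval_map, aeval_def]
  have hcast (m : ℤ) : α + ((m + 1 : ℤ) : Cbar C) = α + (m : Cbar C) + 1 := by
    push_cast; ring
  have hSpan (m : ℤ) : Smap C ℓ r g ∈ localSpanSubmodule (α + (m : Cbar C)) W
      ↔ g ∈ localSpanSubmodule (α + ((m + 1 : ℤ) : Cbar C)) W := by
    have h' := hW (m + 1)
    rw [hcast] at h' ⊢
    exact Smap_mem_localSpanSubmodule_iff hℓ (hW m) h'
  have hSg : Smap C ℓ r g = f + g := by rw [hfg, Dmap, sub_add_cancel]
  set Z : Set ℤ := {m | aeval (α + (m : Cbar C)) v = 0} with hZ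
  have hZfin : Z.Finite := by
    refine Set.Finite.of_finite_image (f := fun m : ℤ => α + (m : Cbar C)) ?_ ?_
    · refine (v.rootSet_finite (Cbar C)).subset ?_
      rintro _ ⟨m, hm, rfl⟩
      exact (mem_rootSet_of_ne hv).mpr hm
    · intro m _ n _ h
      simpa using h
  have hZne : Z.Nonempty := by
    obtain ⟨m, hm, -⟩ := hdisp
    exact ⟨m, by rwa [heval] at hm⟩
  obtain ⟨m₀, hm₀, hmin⟩ := Set.exists_min_image Z id hZfin hZne
  obtain ⟨m₁, hm₁, hmax⟩ := Set.exists_max_image Z id hZfin hZne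
  simp only [id] at hmin hmax
  have hgmem (m : ℤ) (hm : m ∉ Z) : g ∈ localSpanSubmodule (α + (m : Cbar C)) W :=
    inv_smul_sum_mem_localSpanSubmodule b hm
  have hgnot (m : ℤ) (hm : m ∈ Z) : g ∉ localSpanSubmodule (α + (m : Cbar C)) W :=
    inv_smul_sum_notMem_localSpanSubmodule hWb.1 b hv hgcdv hm
  have hu₁ : aeval (α + (m₁ : Cbar C)) u = 0 := by
    by_contra hne
    refine hgnot m₁ hm₁ ?_
    have h1 := (hSpan m₁).mpr (hgmem _ fun h => by have := hmax _ h; omega)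
    rw [hSg] at h1
    exact (Submodule.add_mem_iff_right _ (inv_smul_sum_mem_localSpanSubmodule a hne)).mp h1
  have hu₀ : aeval (α + ((m₀ - 1 : ℤ) : Cbar C)) u = 0 := by
    by_contra hne
    refine hgnot m₀ hm₀ ?_
    have h1 := hSpan (m₀ - 1)
    rw [sub_add_cancel, hSg] at h1
    exact h1.mp (Submodule.add_mem _ (inv_smul_sum_mem_localSpanSubmodule a hne)
      (hgmem _ fun h => by have := hmin _ h; omega))
  obtain ⟨k, hk⟩ : ∃ k : ℕ, m₁ = m₀ + k := Int.le.dest (hmin m₁ hm₁) |>.imp fun _ h => h.symm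
  have hvle : dispVal C α (v.map (algebraMap C (Cbar C))) ≤ k := by
    refine sSup_le ?_
    rintro _ ⟨j, ⟨m, h1, h2⟩, rfl⟩
    rw [heval] at h1 h2
    have h3 := hmin m h1
    have h4 := hmax (m + j) (by simpa [hZ, ← add_assoc] using h2)
    exact Nat.cast_le.mpr (by omega)
  refine (add_le_add_left hvle 1).trans (le_sSup ⟨k + 1, ⟨m₀ - 1, ?_, ?_⟩, by simp⟩)
  · rw [heval, hu₀]
  · rw [heval, ← hu₁, hk]
    congr 2
    push_cast
    ring

end PRec
end
end
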